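/- Let S and A be metric spaces, K ≥ 0, and Q : S × A → ℝ be K-Lipschitz in the state. Let T be a finite nonempty set of pairs in S × A containing (s,a), and let S_max ≥ 0 be such that dist(s₁,s₂) ≤ S_max for the state components s₁, s₂ of any two pairs in T. Suppose that for every (s',a') ∈ T with Q(s',a') ≠ Q(s,a) one has K·S_max ≤ |Q(s',a') - Q(s,a)|. Let (s*,a*) ∈ T attain the maximum of Q over T, and define a_new = a* if Q(s*,a*) > Q(s,a) and a_new = a otherwise. Then Q(s,a_new) ≥ Q(s,a). -/

import Mathlib

open Classical in
/-- Theorem 1 of the paper in diameter form: the action selected by the hypercube policy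
regularization framework never decreases the value at `s`. -/
theorem hypercube_theorem_diameter_form {S A : Type*} [MetricSpace S] [MetricSpace A]
    (K : ℝ) (hK : 0 ≤ K) (Q : S × A → ℝ)
    (hLip : ∀ s₁ s₂ : S, ∀ a : A, |Q (s₁, a) - Q (s₂, a)| ≤ K * dist s₁ s₂)
    (T : Finset (S × A)) (s : S) (a : A) (hmem : (s, a) ∈ T)
    (Smax : ℝ) (hSmax : 0 ≤ Smax)
    (hdiam : ∀ p ∈ T, ∀ q ∈ T, dist p.1 q.1 ≤ Smax)
    (hgap : ∀ p ∈ T, Q p ≠ Q (s, a) → K * Smax ≤ |Q p - Q (s, a)|)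
    (pstar : S × A) (hpstar : pstar ∈ T) (hmax : ∀ q ∈ T, Q q ≤ Q pstar)
    (anew : A) (hanew : anew = if Q pstar > Q (s, a) then pstar.2 else a) :
    Q (s, anew) ≥ Q (s, a) := by
  subst hanew
  split_ifs with h
  · have hgap' := hgap pstar hpstar h.ne'
    rw [abs_of_pos (sub_pos.mpr h)] at hgap'
    have hdist := mul_le_mul_of_nonneg_left (hdiam pstar hpstar (s, a) hmem) hK
    have hdiff := (le_abs_self _).trans (hLip pstar.1 s pstar.2)
    linarith
  · exact le_rfl
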